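/- Consider feedforward neural networks of depth D ≥ 2 with widths n_0 = d, n_1, …, n_{D−1} ∈ ℕ⁺, n_D = 1 and activation ρ : ℝ → ℝ satisfying |ρ(t)| ≤ 1 for all t and |ρ(s) − ρ(t)| ≤ |s − t| for all s, t. Let B_θ ≥ 1, let C_c > 0, and let c : ℝ^d → ℝ satisfy |c(x)| ≤ C_c for all x. For parameter vectors θ_u, θ_v whose weights are bounded by B_θ, define h(x; θ_u, θ_v) = c(x) f(x; θ_u) f(x; θ_v). Then for all x ∈ ℝ^d with |x_j| ≤ 1 for all j: (i) |h(x; θ_u, θ_v)| ≤ C_c (n_{D−1} + 1)² B_θ²; and (ii) for any further parameter vectors θ̃_u, θ̃_v with weights bounded by B_θ, |h(x; θ_u, θ_v) − h(x; θ̃_u, θ̃_v)| ≤ C_c √(2W) (n_{D−1} + 1) B_θ^{D} (∏_{i=1}^{D−1} n_i) · ‖(θ_u, θ_v) − (θ̃_u, θ̃_v)‖₂. -/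

import Mathlib

/-- Parameters of a feedforward neural network with widths `n 0, n 1, n 2, …`:
`A ℓ` is the `n (ℓ+1) × n ℓ` weight matrix and `b ℓ` the bias vector of layer `ℓ+1`. -/
structure NNParams (n : ℕ → ℕ) where
  A : (ℓ : ℕ) → Fin (n (ℓ + 1)) → Fin (n ℓ) → ℝ
  b : (ℓ : ℕ) → Fin (n (ℓ + 1)) → ℝ

/-- Hidden-layer outputs: `f⁰(x) = x`, `f^{ℓ+1}(x) = ρ(A_{ℓ+1} f^ℓ(x) + b_{ℓ+1})` entrywise. -/
noncomputable def nnHidden {n : ℕ → ℕ} (ρ : ℝ → ℝ) (θ : NNParams n) :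
    (ℓ : ℕ) → ((Fin (n 0) → ℝ) → Fin (n ℓ) → ℝ)
  | 0 => fun x => x
  | ℓ + 1 => fun x q => ρ ((∑ j, θ.A ℓ q j * nnHidden ρ θ ℓ x j) + θ.b ℓ q)

/-- Network output of depth `D`: the last layer is affine (no activation),
`f(x;θ) = A_D f^{D−1}(x;θ) + b_D`. -/
noncomputable def nnOut {n : ℕ → ℕ} (ρ : ℝ → ℝ) (θ : NNParams n) :
    (D : ℕ) → ((Fin (n 0) → ℝ) → Fin (n D) → ℝ)
  | 0 => fun x => x
  | D + 1 => fun x q => (∑ j, θ.A D q j * nnHidden ρ θ D x j) + θ.b D q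

/-- `W`: the total number of scalar parameters of a depth-`D` network. -/
def nnW (n : ℕ → ℕ) (D : ℕ) : ℕ :=
  ∑ ℓ ∈ Finset.range D, (n (ℓ + 1) * n ℓ + n (ℓ + 1))

/-- Squared Euclidean distance between the parameter vectors of two depth-`D` networks. -/
noncomputable def paramSq {n : ℕ → ℕ} (θ θ' : NNParams n) (D : ℕ) : ℝ :=
  ∑ ℓ ∈ Finset.range D,
    ((∑ q, ∑ j, (θ.A ℓ q j - θ'.A ℓ q j) ^ 2) + ∑ q, (θ.b ℓ q - θ'.b ℓ q) ^ 2)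

/-- Euclidean distance `‖θ − θ̃‖₂` between the parameter vectors of two depth-`D` networks. -/
noncomputable def paramDist {n : ℕ → ℕ} (θ θ' : NNParams n) (D : ℕ) : ℝ :=
  Real.sqrt (paramSq θ θ' D)

/-- All weights of the depth-`D` network `θ` are bounded in absolute value by `Bθ`. -/
def weightsBounded {n : ℕ → ℕ} (θ : NNParams n) (D : ℕ) (Bθ : ℝ) : Prop :=
  ∀ ℓ < D, (∀ q j, |θ.A ℓ q j| ≤ Bθ) ∧ (∀ q, |θ.b ℓ q| ≤ Bθ)

/-- Euclidean distance `‖(θu, θv) − (θ̃u, θ̃v)‖₂` between two pairs of depth-`D`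
parameter vectors (the pair being regarded as a vector in `ℝ^{2W}`). -/
noncomputable def pairDist {n : ℕ → ℕ} (θu θv θu' θv' : NNParams n) (D : ℕ) : ℝ :=
  Real.sqrt (paramSq θu θu' D + paramSq θv θv' D)

open Finset in
/-- Cauchy–Schwarz for sums of quantities that are themselves bounded by `√w * √p`. -/
theorem sum_le_sqrt_mul_sqrt_of_le {ι : Type*} (t : Finset ι) {s w p : ι → ℝ}
    (hw : ∀ i, 0 ≤ w i) (hp : ∀ i, 0 ≤ p i) (h : ∀ i, s i ≤ √(w i) * √(p i)) :
    ∑ i ∈ t, s i ≤ √(∑ i ∈ t, w i) * √(∑ i ∈ t, p i) :=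
  (sum_le_sum fun i _ => h i).trans (Real.sum_sqrt_mul_sqrt_le t hw hp)

/-- Two-term version of `sum_le_sqrt_mul_sqrt_of_le`. -/
theorem add_le_sqrt_mul_sqrt_of_le {s s' w w' p p' : ℝ} (hw : 0 ≤ w) (hw' : 0 ≤ w')
    (hp : 0 ≤ p) (hp' : 0 ≤ p') (h : s ≤ √w * √p) (h' : s' ≤ √w' * √p') :
    s + s' ≤ √(w + w') * √(p + p') := by
  have := sum_le_sqrt_mul_sqrt_of_le Finset.univ (s := ![s, s']) (w := ![w, w']) (p := ![p, p'])
    (by simp [Fin.forall_fin_two, hw, hw']) (by simp [Fin.forall_fin_two, hp, hp'])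
    (by simp [Fin.forall_fin_two, h, h'])
  simpa using this

/-- The `ℓ¹` distance between two finite families of reals is at most the square root of the
number of entries times the `ℓ²` distance. -/
theorem sum_abs_sub_le_sqrt_card_mul_sqrt {ι : Type*} [Fintype ι] (a a' : ι → ℝ) :
    ∑ i, |a i - a' i| ≤ √(Fintype.card ι : ℝ) * √(∑ i, (a i - a' i) ^ 2) := by
  have := sum_le_sqrt_mul_sqrt_of_le Finset.univ (s := fun i => |a i - a' i|) (w := fun _ => 1)
    (p := fun i => (a i - a' i) ^ 2) (fun _ => zero_le_one) (fun _ => sq_nonneg _)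
    (fun i => by simp [Real.sqrt_sq_eq_abs])
  simpa using this

namespace NNParams

variable {n : ℕ → ℕ}

/-- The `ℓ¹` distance between the parameters of layer `ℓ + 1` of two networks. -/
def layerL1 (θ θ' : NNParams n) (ℓ : ℕ) : ℝ :=
  (∑ q, ∑ j, |θ.A ℓ q j - θ'.A ℓ q j|) + ∑ q, |θ.b ℓ q - θ'.b ℓ q|

/-- The `ℓ¹` distance between the parameter vectors of two depth-`D` networks. -/
def paramL1 (θ θ' : NNParams n) (D : ℕ) : ℝ :=
  ∑ ℓ ∈ Finset.range D, layerL1 θ θ' ℓ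

theorem layerL1_nonneg (θ θ' : NNParams n) (ℓ : ℕ) : 0 ≤ layerL1 θ θ' ℓ := by
  unfold layerL1; positivity

theorem paramL1_nonneg (θ θ' : NNParams n) (D : ℕ) : 0 ≤ paramL1 θ θ' D :=
  Finset.sum_nonneg fun _ _ => layerL1_nonneg _ _ _

theorem paramSq_nonneg (θ θ' : NNParams n) (D : ℕ) : 0 ≤ paramSq θ θ' D := by
  unfold paramSq; positivity

theorem paramL1_le (θ θ' : NNParams n) (D : ℕ) :
    paramL1 θ θ' D ≤ √(nnW n D : ℝ) * √(paramSq θ θ' D) := by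
  unfold paramL1 nnW paramSq
  push_cast
  refine sum_le_sqrt_mul_sqrt_of_le _ (fun ℓ => by positivity) (fun ℓ => by positivity) fun ℓ => ?_
  refine add_le_sqrt_mul_sqrt_of_le (by positivity) (by positivity) (by positivity)
    (by positivity) ?_ ?_
  · have := sum_le_sqrt_mul_sqrt_of_le Finset.univ (fun _ => by positivity)
      (fun _ => by positivity)
      (fun q => sum_abs_sub_le_sqrt_card_mul_sqrt (θ.A ℓ q) (θ'.A ℓ q))
    simpa using this
  · simpa using sum_abs_sub_le_sqrt_card_mul_sqrt (θ.b ℓ) (θ'.b ℓ)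

/-- The `ℓ¹` distance between the parameters feeding a single neuron is at most that of the
whole layer. -/
theorem neuron_le_layerL1 (θ θ' : NNParams n) (ℓ : ℕ) (q : Fin (n (ℓ + 1))) :
    (∑ j, |θ.A ℓ q j - θ'.A ℓ q j|) + |θ.b ℓ q - θ'.b ℓ q| ≤ layerL1 θ θ' ℓ :=
  add_le_add
    (Finset.single_le_sum (f := fun q => ∑ j, |θ.A ℓ q j - θ'.A ℓ q j|)
      (fun _ _ => by positivity) (Finset.mem_univ q))
    (Finset.single_le_sum (f := fun q => |θ.b ℓ q - θ'.b ℓ q|)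
      (fun _ _ => by positivity) (Finset.mem_univ q))

end NNParams

open NNParams

section Network

variable {n : ℕ → ℕ} {ρ : ℝ → ℝ} {x : Fin (n 0) → ℝ} {B : ℝ}

theorem abs_nnHidden_le_one (hρb : ∀ t, |ρ t| ≤ 1) (hx : ∀ j, |x j| ≤ 1) (θ : NNParams n)
    (ℓ : ℕ) (q : Fin (n ℓ)) : |nnHidden ρ θ ℓ x q| ≤ 1 := by
  cases ℓ with
  | zero => exact hx q
  | succ ℓ => exact hρb _

theorem abs_nnOut_le (hρb : ∀ t, |ρ t| ≤ 1) (hx : ∀ j, |x j| ≤ 1) {θ : NNParams n} {k : ℕ}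
    (hθ : weightsBounded θ (k + 1) B) (q : Fin (n (k + 1))) :
    |nnOut ρ θ (k + 1) x q| ≤ ((n k : ℝ) + 1) * B := by
  obtain ⟨hA, hb⟩ := hθ k k.lt_succ_self
  have hterm : ∀ j, |θ.A k q j * nnHidden ρ θ k x j| ≤ B := fun j => by
    rw [abs_mul]
    exact (mul_le_of_le_one_right (abs_nonneg _) (abs_nnHidden_le_one hρb hx θ k j)).trans
      (hA q j)
  calc |nnOut ρ θ (k + 1) x q|
      ≤ (∑ j, |θ.A k q j * nnHidden ρ θ k x j|) + |θ.b k q| :=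
        (abs_add_le _ _).trans (by gcongr; exact Finset.abs_sum_le_sum_abs _ _)
    _ ≤ (∑ _j : Fin (n k), B) + B := by
        gcongr with j
        · exact hterm j
        · exact hb q
    _ = ((n k : ℝ) + 1) * B := by simp; ring

/-- One layer of error propagation. -/
theorem abs_nnOut_sub_le_layer (hρb : ∀ t, |ρ t| ≤ 1) (hx : ∀ j, |x j| ≤ 1)
    {θ θ' : NNParams n} {k : ℕ} (hθ' : weightsBounded θ' (k + 1) B) {ε : ℝ}
    (hε : ∀ j, |nnHidden ρ θ k x j - nnHidden ρ θ' k x j| ≤ ε) (q : Fin (n (k + 1))) :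
    |nnOut ρ θ (k + 1) x q - nnOut ρ θ' (k + 1) x q| ≤ layerL1 θ θ' k + n k * (B * ε) := by
  have hA := (hθ' k k.lt_succ_self).1
  have hsplit : nnOut ρ θ (k + 1) x q - nnOut ρ θ' (k + 1) x q =
      (∑ j, ((θ.A k q j - θ'.A k q j) * nnHidden ρ θ k x j +
        θ'.A k q j * (nnHidden ρ θ k x j - nnHidden ρ θ' k x j))) + (θ.b k q - θ'.b k q) := by
    simp only [nnOut]
    rw [add_sub_add_comm, ← Finset.sum_sub_distrib]
    congr 1
    exact Finset.sum_congr rfl fun j _ => by ring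
  have hterm : ∀ j, |(θ.A k q j - θ'.A k q j) * nnHidden ρ θ k x j +
      θ'.A k q j * (nnHidden ρ θ k x j - nnHidden ρ θ' k x j)| ≤
      |θ.A k q j - θ'.A k q j| + B * ε := fun j => by
    refine (abs_add_le _ _).trans (add_le_add ?_ ?_)
    · rw [abs_mul]
      exact mul_le_of_le_one_right (abs_nonneg _) (abs_nnHidden_le_one hρb hx θ k j)
    · rw [abs_mul]
      exact mul_le_mul (hA q j) (hε j) (abs_nonneg _) ((abs_nonneg _).trans (hA q j))
  rw [hsplit]
  calc _ ≤ (∑ j, (|θ.A k q j - θ'.A k q j| + B * ε)) + |θ.b k q - θ'.b k q| := by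
        refine (abs_add_le _ _).trans ?_
        gcongr
        exact (Finset.abs_sum_le_sum_abs _ _).trans (Finset.sum_le_sum fun j _ => hterm j)
    _ = (∑ j, |θ.A k q j - θ'.A k q j|) + |θ.b k q - θ'.b k q| + n k * (B * ε) := by
        rw [Finset.sum_add_distrib]; simp; ring
    _ ≤ _ := by gcongr; exact neuron_le_layerL1 θ θ' k q

/-- The network output is Lipschitz in its parameters with respect to the `ℓ¹` distance. -/
theorem abs_nnOut_sub_le (hρb : ∀ t, |ρ t| ≤ 1) (hρlip : ∀ s t, |ρ s - ρ t| ≤ |s - t|)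
    (hx : ∀ j, |x j| ≤ 1) (hB : 1 ≤ B) {θ θ' : NNParams n} {k : ℕ}
    (hpos : ∀ i ≤ k, 0 < n i) (hθ' : weightsBounded θ' (k + 1) B) (q : Fin (n (k + 1))) :
    |nnOut ρ θ (k + 1) x q - nnOut ρ θ' (k + 1) x q| ≤
      B ^ k * (∏ i ∈ Finset.Icc 1 k, (n i : ℝ)) * paramL1 θ θ' (k + 1) := by
  induction k with
  | zero =>
    refine (abs_nnOut_sub_le_layer hρb hx hθ' (ε := 0) (fun j => ?_) q).trans ?_
    · simp [nnHidden]
    · simp [paramL1]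
  | succ k ih =>
    have hhid := fun j => (hρlip _ _).trans
      (ih (fun i hi => hpos i (by omega)) (fun ℓ hℓ => hθ' ℓ (by omega)) j)
    refine (abs_nnOut_sub_le_layer hρb hx hθ' hhid q).trans ?_
    have hprod : (1 : ℝ) ≤ B ^ (k + 1) * ∏ i ∈ Finset.Icc 1 (k + 1), (n i : ℝ) := by
      refine one_le_mul_of_one_le_of_one_le (one_le_pow₀ hB) ?_
      rw [← Nat.cast_prod, Nat.one_le_cast]
      exact Finset.prod_pos fun i hi => hpos i (Finset.mem_Icc.1 hi).2
    have hlayer := le_mul_of_one_le_left (layerL1_nonneg θ θ' (k + 1)) hprod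
    have hL1 : paramL1 θ θ' (k + 1 + 1) = paramL1 θ θ' (k + 1) + layerL1 θ θ' (k + 1) :=
      Finset.sum_range_succ _ _
    rw [hL1, mul_add, add_comm]
    refine add_le_add (le_of_eq ?_) hlayer
    rw [Finset.prod_Icc_succ_top (by omega)]
    ring

end Network

/-- **Lemma 5.12, class `F₃ = {c u v}`.** For depth `D ≥ 2` networks with widths
`n 0 = d ≥ 1`, …, `n D = 1`, activation `ρ` bounded by `1` and `1`-Lipschitz, coefficient
`|c| ≤ C_c`, and parameter vectors with weights bounded by `Bθ ≥ 1`, the function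
`h(x; θu, θv) = c(x) f(x;θu) f(x;θv)` satisfies, for every `x` with `|x j| ≤ 1`:
(i) `|h(x; θu, θv)| ≤ C_c (n (D−1) + 1)² Bθ²`, and
(ii) `|h(x; θu, θv) − h(x; θ̃u, θ̃v)|
      ≤ C_c √(2W) (n (D−1) + 1) Bθ^D (∏_{i=1}^{D−1} n i) ‖(θu,θv) − (θ̃u,θ̃v)‖₂`. -/
theorem galerkin_zeroth_order_class_bounds (D : ℕ) (hD : 2 ≤ D) (n : ℕ → ℕ)
    (hd : 1 ≤ n 0) (hnD : n D = 1) (hpos : ∀ i ≤ D, 0 < n i)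
    (ρ : ℝ → ℝ) (hρb : ∀ t, |ρ t| ≤ 1) (hρlip : ∀ s t, |ρ s - ρ t| ≤ |s - t|)
    (Bθ : ℝ) (hBθ : 1 ≤ Bθ) (Cc : ℝ) (hCc : 0 < Cc)
    (c : (Fin (n 0) → ℝ) → ℝ) (hc : ∀ x, |c x| ≤ Cc)
    (θu θv : NNParams n) (hθu : weightsBounded θu D Bθ) (hθv : weightsBounded θv D Bθ)
    (x : Fin (n 0) → ℝ) (hx : ∀ j, |x j| ≤ 1) (qu qv : Fin (n D)) :
    (|c x * nnOut ρ θu D x qu * nnOut ρ θv D x qv| ≤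
        Cc * ((n (D - 1) : ℝ) + 1) ^ 2 * Bθ ^ 2) ∧
    (∀ θu' θv' : NNParams n, weightsBounded θu' D Bθ → weightsBounded θv' D Bθ →
      |c x * nnOut ρ θu D x qu * nnOut ρ θv D x qv -
          c x * nnOut ρ θu' D x qu * nnOut ρ θv' D x qv| ≤
        Cc * Real.sqrt (2 * nnW n D) * ((n (D - 1) : ℝ) + 1) * Bθ ^ D *
          (∏ i ∈ Finset.Icc 1 (D - 1), (n i : ℝ)) * pairDist θu θv θu' θv' D) := by
  obtain ⟨k, rfl⟩ : ∃ k, D = k + 1 := ⟨D - 1, by omega⟩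
  simp only [Nat.add_sub_cancel]
  have hu := abs_nnOut_le hρb hx hθu qu
  have hv := abs_nnOut_le hρb hx hθv qv
  refine ⟨?_, fun θu' θv' hθu' hθv' => ?_⟩
  · calc |c x * nnOut ρ θu (k + 1) x qu * nnOut ρ θv (k + 1) x qv|
        = |c x| * |nnOut ρ θu (k + 1) x qu| * |nnOut ρ θv (k + 1) x qv| := by
          rw [abs_mul, abs_mul]
      _ ≤ Cc * (((n k : ℝ) + 1) * Bθ) * (((n k : ℝ) + 1) * Bθ) := by
          gcongr
          exact hc x
      _ = Cc * ((n k : ℝ) + 1) ^ 2 * Bθ ^ 2 := by ring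
  · have hu' := abs_nnOut_le hρb hx hθu' qu
    have hpos' : ∀ i ≤ k, 0 < n i := fun i hi => hpos i (by omega)
    have hdu := abs_nnOut_sub_le (θ := θu) hρb hρlip hx hBθ hpos' hθu' qu
    have hdv := abs_nnOut_sub_le (θ := θv) hρb hρlip hx hBθ hpos' hθv' qv
    have hL1 : paramL1 θu θu' (k + 1) + paramL1 θv θv' (k + 1) ≤
        √(2 * nnW n (k + 1)) * pairDist θu θv θu' θv' (k + 1) := by
      rw [two_mul]
      exact add_le_sqrt_mul_sqrt_of_le (by positivity) (by positivity) (paramSq_nonneg _ _ _)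
        (paramSq_nonneg _ _ _) (paramL1_le _ _ _) (paramL1_le _ _ _)
    set U := nnOut ρ θu (k + 1) x qu
    set V := nnOut ρ θv (k + 1) x qv
    set U' := nnOut ρ θu' (k + 1) x qu
    set V' := nnOut ρ θv' (k + 1) x qv
    set P := ∏ i ∈ Finset.Icc 1 k, (n i : ℝ)
    have hP : 0 ≤ P := by positivity
    calc |c x * U * V - c x * U' * V'|
        = |c x| * |(U - U') * V + U' * (V - V')| := by rw [← abs_mul]; ring_nf
      _ ≤ |c x| * (|U - U'| * |V| + |U'| * |V - V'|) := by
          rw [← abs_mul (U - U'), ← abs_mul U']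
          gcongr
          exact abs_add_le _ _
      _ ≤ Cc * (Bθ ^ k * P * paramL1 θu θu' (k + 1) * (((n k : ℝ) + 1) * Bθ) +
            ((n k : ℝ) + 1) * Bθ * (Bθ ^ k * P * paramL1 θv θv' (k + 1))) := by
          have := paramL1_nonneg θu θu' (k + 1)
          gcongr
          exact hc x
      _ = Cc * (((n k : ℝ) + 1) * Bθ ^ (k + 1) * P) *
            (paramL1 θu θu' (k + 1) + paramL1 θv θv' (k + 1)) := by ring
      _ ≤ Cc * (((n k : ℝ) + 1) * Bθ ^ (k + 1) * P) *
            (√(2 * nnW n (k + 1)) * pairDist θu θv θu' θv' (k + 1)) := by gcongr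
      _ = _ := by ring
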